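/- Let Φ ∈ ℝ^{m×N} satisfy the RIP of order t with constant δ ∈ [0,1], and let μ ≥ 0 be a real number. Then for any vector v ∈ ℝ^N and any set U ⊆ {1,…,N} with |U ∪ supp(v)| ≤ t, one has ‖((I − μΦ*Φ)v)_U‖₂ ≤ (|μ−1| + μδ)·‖v‖₂, where I is the N×N identity matrix. -/

import Mathlib

open Matrix Finset

/-- The Euclidean norm of a vector in `ℝⁿ`. -/
noncomputable def norm2 {n : ℕ} (v : Fin n → ℝ) : ℝ := Real.sqrt (∑ i, (v i) ^ 2)

/-- The support of a vector: the set of indices of its nonzero entries. -/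
noncomputable def supp {n : ℕ} (v : Fin n → ℝ) : Finset (Fin n) :=
  Finset.univ.filter (fun i => v i ≠ 0)

/-- `restrict v T` keeps the entries of `v` with indices in `T` and sets all others to zero. -/
def restrict {n : ℕ} (v : Fin n → ℝ) (T : Finset (Fin n)) : Fin n → ℝ :=
  fun i => if i ∈ T then v i else 0

/-- `Φ` satisfies the restricted isometry property of order `t` with constant `δ`. -/
def RIP (m N : ℕ) (Φ : Matrix (Fin m) (Fin N) ℝ) (t : ℕ) (δ : ℝ) : Prop :=
  ∀ v : Fin N → ℝ, (supp v).card ≤ t →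
    (1 - δ) * (norm2 v) ^ 2 ≤ (norm2 (Φ.mulVec v)) ^ 2 ∧
    (norm2 (Φ.mulVec v)) ^ 2 ≤ (1 + δ) * (norm2 v) ^ 2

/-- `z` is a least-squares solution over support `T` for data `y`. -/
def IsLeastSquares {m N : ℕ} (Φ : Matrix (Fin m) (Fin N) ℝ) (y : Fin m → ℝ)
    (T : Finset (Fin N)) (z : Fin N → ℝ) : Prop :=
  supp z ⊆ T ∧ ∀ w : Fin N → ℝ, supp w ⊆ T →
    norm2 (y - Φ.mulVec z) ≤ norm2 (y - Φ.mulVec w)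

/-- `U` is a set of indices of the `k` largest magnitude entries of `v`. -/
def IsLargest {n : ℕ} (v : Fin n → ℝ) (k : ℕ) (U : Finset (Fin n)) : Prop :=
  U.card = k ∧ ∀ i ∈ U, ∀ j ∉ U, |v j| ≤ |v i|

theorem norm2_sq' {n : ℕ} (v : Fin n → ℝ) : norm2 v ^ 2 = v ⬝ᵥ v := by
  unfold norm2
  rw [Real.sq_sqrt (Finset.sum_nonneg fun i _ => sq_nonneg _)]
  simp [dotProduct, sq]

theorem norm2_nonneg' {n : ℕ} (v : Fin n → ℝ) : 0 ≤ norm2 v := Real.sqrt_nonneg _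

theorem abs_dot_le' {n : ℕ} (w v : Fin n → ℝ) : |w ⬝ᵥ v| ≤ norm2 w * norm2 v := by
  refine abs_le_of_sq_le_sq ?_ (mul_nonneg (norm2_nonneg' w) (norm2_nonneg' v))
  rw [mul_pow, norm2_sq', norm2_sq']
  have := Finset.sum_mul_sq_le_sq_mul_sq Finset.univ w v
  simpa [dotProduct, sq] using this

theorem polar' {m N : ℕ} (Φ : Matrix (Fin m) (Fin N) ℝ) (t : ℕ) (δ : ℝ)
    (hRIP : RIP m N Φ t δ) (w v : Fin N → ℝ) (S : Finset (Fin N)) (hS : S.card ≤ t)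
    (hw : ∀ i, i ∉ S → w i = 0) (hv : ∀ i, i ∉ S → v i = 0)
    (hp : 0 < norm2 w) (hq : 0 < norm2 v) :
    w ⬝ᵥ v - Φ.mulVec w ⬝ᵥ Φ.mulVec v ≤ δ * (norm2 w * norm2 v) := by
  have key : ∀ a b : ℝ, (1 - δ) * ((a • w + b • v) ⬝ᵥ (a • w + b • v)) ≤
      (Φ.mulVec (a • w + b • v)) ⬝ᵥ (Φ.mulVec (a • w + b • v)) ∧
      (Φ.mulVec (a • w + b • v)) ⬝ᵥ (Φ.mulVec (a • w + b • v)) ≤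
      (1 + δ) * ((a • w + b • v) ⬝ᵥ (a • w + b • v)) := by
    intro a b
    have := hRIP (a • w + b • v) (le_trans (Finset.card_le_card (by
      intro i hi
      by_contra h
      simp [supp, hw i h, hv i h] at hi)) hS)
    simpa only [norm2_sq'] using this
  have h1 := (key (norm2 v) (norm2 w)).1
  have h2 := (key (norm2 v) (-norm2 w)).2
  simp only [mulVec_add, mulVec_smul, dotProduct_add, add_dotProduct, smul_dotProduct,
    dotProduct_smul, smul_eq_mul, dotProduct_comm v w,
    dotProduct_comm (Φ.mulVec v) (Φ.mulVec w), ← norm2_sq'] at h1 h2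
  have hpq := mul_pos hp hq
  generalize norm2 w = p at *
  generalize norm2 v = q at *
  refine le_of_mul_le_mul_left ?_ hpq
  linarith

theorem stmt_1 {m N : ℕ} (Φ : Matrix (Fin m) (Fin N) ℝ) (t : ℕ) (δ μ : ℝ)
    (hδ0 : 0 ≤ δ) (hδ1 : δ ≤ 1) (hμ : 0 ≤ μ) (hRIP : RIP m N Φ t δ)
    (v : Fin N → ℝ) (U : Finset (Fin N)) (hcard : (U ∪ supp v).card ≤ t) :
    norm2 (restrict (fun i => v i - μ * (Φᵀ.mulVec (Φ.mulVec v)) i) U) ≤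
      (|μ - 1| + μ * δ) * norm2 v := by
  classical
  set w := restrict (fun i => v i - μ * (Φᵀ.mulVec (Φ.mulVec v)) i) U with hwdef
  have hC : 0 ≤ |μ - 1| + μ * δ := by positivity
  rcases (norm2_nonneg' w).eq_or_lt with hp | hp
  · rw [← hp]
    exact mul_nonneg hC (norm2_nonneg' v)
  rcases (norm2_nonneg' v).eq_or_lt with hq | hq
  · exfalso
    have h0 : v ⬝ᵥ v = 0 := by rw [← norm2_sq', ← hq]; simp
    have hv : v = 0 := dotProduct_self_eq_zero.mp h0
    have hw0 : w = 0 := by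
      rw [hwdef]
      funext i
      simp [_root_.restrict, hv]
    rw [hw0] at hp
    simp [norm2] at hp
  have hpol := polar' Φ t δ hRIP w v (U ∪ supp v) hcard
    (by
      intro i hi
      have : i ∉ U := fun h => hi (Finset.mem_union_left _ h)
      simp [hwdef, _root_.restrict, this])
    (by
      intro i hi
      by_contra h
      exact hi (Finset.mem_union_right _ (by simp [supp, h]))) hp hq
  have hww : norm2 w ^ 2 = w ⬝ᵥ v - μ * (Φ.mulVec w ⬝ᵥ Φ.mulVec v) := by
    have e1 : Φ.mulVec w ⬝ᵥ Φ.mulVec v = w ⬝ᵥ Φᵀ.mulVec (Φ.mulVec v) := by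
      rw [dotProduct_mulVec w, vecMul_transpose]
    rw [norm2_sq', e1]
    simp only [dotProduct, Finset.mul_sum]
    rw [← Finset.sum_sub_distrib]
    refine Finset.sum_congr rfl fun i _ => ?_
    by_cases h : i ∈ U
    · have : w i = v i - μ * (Φᵀ.mulVec (Φ.mulVec v)) i := by simp [hwdef, _root_.restrict, h]
      nth_rewrite 2 [this]
      ring
    · have : w i = 0 := by simp [hwdef, _root_.restrict, h]
      simp [this]
  have hcs : (1 - μ) * (w ⬝ᵥ v) ≤ |μ - 1| * (norm2 w * norm2 v) := by
    refine (le_abs_self _).trans ?_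
    rw [abs_mul, abs_sub_comm]
    exact mul_le_mul_of_nonneg_left (abs_dot_le' w v) (abs_nonneg _)
  have hm := mul_le_mul_of_nonneg_left hpol hμ
  refine le_of_mul_le_mul_left ?_ hp
  linarith
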